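/- Let k ≥ 3 be an integer and let G be a 2-connected K_3-free finite simple graph of minimum degree at least k which is not isomorphic to K_{k,n} for any n ≥ k and which contains no cycle of length at least 2k+2. Then for every longest path P = v_0 v_1 … v_ℓ in G (of length ℓ), all neighbors of v_0 lie on P, the vertex v_0 has exactly k neighbors, the vertices v_0 and v_ℓ are non-adjacent, G contains no cycle of length ℓ+1, and ℓ ≥ 2k. -/

import Mathlib

/-- `G` contains a cycle of length `n`. -/
def HasCycleLength {V : Type*} (G : SimpleGraph V) (n : ℕ) : Prop :=
  ∃ (u : V) (c : G.Walk u u), c.IsCycle ∧ c.length = n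

/-- A finite graph is 2-connected: it has at least 3 vertices and remains connected after
deleting any single vertex. -/
def TwoConnected {V : Type*} [Fintype V] (G : SimpleGraph V) : Prop :=
  3 ≤ Fintype.card V ∧ ∀ v : V, (G.induce ({v}ᶜ : Set V)).Connected

open SimpleGraph

lemma aux_cycle {V : Type*} {G : SimpleGraph V} {u v : V} (p : G.Walk u v) (hp : p.IsPath)
    (hl : 2 ≤ p.length) (h : G.Adj v u) : HasCycleLength G (p.length + 1) := by
  refine ⟨v, Walk.cons h p, ?_, by simp⟩
  rw [Walk.isCycle_iff_isPath_tail_and_le_length]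
  refine ⟨by simpa using hp, by simp; omega⟩

lemma aux_tri {V : Type*} {G : SimpleGraph V} (htf : G.CliqueFree 3) {a b c : V}
    (h1 : G.Adj a b) (h2 : G.Adj a c) (h3 : G.Adj b c) : False := by
  classical
  exact htf {a, b, c} (is3Clique_triple_iff.2 ⟨h1, h2, h3⟩)

lemma aux_conn {V : Type*} [Fintype V] {G : SimpleGraph V} (h2 : TwoConnected G) :
    G.Preconnected := by
  classical
  intro a b
  obtain ⟨c, hc⟩ : ∃ c, c ∉ ({a, b} : Finset V) := by
    by_contra! h
    have h3 := h2.1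
    have : (Finset.univ : Finset V) ⊆ {a, b} := fun x _ => h x
    have := Finset.card_le_card this
    have h4 := Finset.card_le_two (a := a) (b := b)
    rw [Finset.card_univ] at this
    omega
  simp at hc
  have := (h2.2 c).preconnected ⟨a, by simp; tauto⟩ ⟨b, by simp; tauto⟩
  exact this.map (Embedding.induce _).toHom

lemma aux_idx (S : Finset ℕ) (hne : S.Nonempty) (h0 : 0 ∉ S) (hs : ∀ i ∈ S, i + 1 ∉ S) :
    ∃ i ∈ S, 2 * S.card ≤ i + 1 := by
  refine ⟨S.max' hne, S.max'_mem hne, ?_⟩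
  have hd : Disjoint S (S.image (· + 1)) := by
    rw [Finset.disjoint_left]
    intro a ha hb
    obtain ⟨b, hb', rfl⟩ := Finset.mem_image.1 hb
    exact hs b hb' ha
  have hsub : S ∪ S.image (· + 1) ⊆ Finset.Icc 1 (S.max' hne + 1) := by
    intro a ha
    rw [Finset.mem_Icc]
    rcases Finset.mem_union.1 ha with h | h
    · have := S.le_max' a h
      have : a ≠ 0 := fun h' => h0 (h' ▸ h)
      omega
    · obtain ⟨b, hb, rfl⟩ := Finset.mem_image.1 h
      have := S.le_max' b hb
      omega
  have := Finset.card_le_card hsub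
  rw [Finset.card_union_of_disjoint hd,
    Finset.card_image_of_injective _ (add_left_injective 1)] at this
  simp at this
  omega

lemma aux_iso {V : Type*} [Fintype V] [DecidableEq V] {G : SimpleGraph V} (A : Finset V) (k : ℕ)
    (hA : A.card = k) (h : ∀ x y, G.Adj x y ↔ (x ∈ A ↔ y ∉ A)) :
    Nonempty (G ≃g completeBipartiteGraph (Fin k) (Fin (Aᶜ).card)) := by
  let e1 : {x // x ∈ A} ≃ Fin k := A.equivFinOfCardEq hA
  let e2 : {x // ¬ x ∈ A} ≃ Fin (Aᶜ).card :=
    (Equiv.subtypeEquivRight (by simp)).trans (Aᶜ).equivFin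
  let e : Fin k ⊕ Fin (Aᶜ).card ≃ V := (Equiv.sumCongr e1 e2).symm.trans (Equiv.sumCompl (· ∈ A))
  refine ⟨Iso.symm ⟨e, ?_⟩⟩
  have hl : ∀ i, e (Sum.inl i) ∈ A := fun i => by simp [e]
  have hr : ∀ i, e (Sum.inr i) ∉ A := fun i => by
    simpa [e] using (e2.symm i).2
  intro a b
  rw [h]
  rcases a with a | a <;> rcases b with b | b <;>
    simp only [hl, hr, completeBipartiteGraph_adj] <;> simp

/-- A bipartition of a small graph gives `K_{k,n}`. -/
lemma aux_bip {V : Type*} [Fintype V] [DecidableEq V] [Nonempty V] {k : ℕ} (hk : 1 ≤ k)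
    {G : SimpleGraph V} [DecidableRel G.Adj] (hdeg : ∀ v : V, k ≤ G.degree v)
    (A : Finset V) (hA : A.card ≤ k) (h : ∀ x y, G.Adj x y → (x ∈ A ↔ y ∉ A)) :
    ∃ n, k ≤ n ∧ Nonempty (G ≃g completeBipartiteGraph (Fin k) (Fin n)) := by
  have hsub : ∀ x ∉ A, G.neighborFinset x ⊆ A := by
    intro x hx y hy
    have := h x y (by simpa using hy)
    tauto
  have hsub' : ∀ x ∈ A, G.neighborFinset x ⊆ Aᶜ := by
    intro x hx y hy
    have := h x y (by simpa using hy)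
    rw [Finset.mem_compl]
    tauto
  have heq : ∀ x ∉ A, G.neighborFinset x = A := by
    intro x hx
    apply Finset.eq_of_subset_of_card_le (hsub x hx)
    rw [card_neighborFinset_eq_degree]
    exact hA.trans (hdeg x)
  have hne : ∃ x, x ∉ A := by
    obtain ⟨u⟩ := ‹Nonempty V›
    by_cases hu : u ∈ A
    · have : 0 < (G.neighborFinset u).card := by
        rw [card_neighborFinset_eq_degree]; have := hdeg u; omega
      obtain ⟨w, hw⟩ := Finset.card_pos.1 this
      exact ⟨w, by simpa using hsub' u hu hw⟩
    · exact ⟨u, hu⟩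
  obtain ⟨x, hx⟩ := hne
  have hAk : A.card = k := by
    have := hdeg x
    rw [← card_neighborFinset_eq_degree, heq x hx] at this
    omega
  refine ⟨_, ?_, aux_iso A k hAk ?_⟩
  · have : 0 < A.card := by omega
    obtain ⟨a, ha⟩ := Finset.card_pos.1 this
    have h1 := Finset.card_le_card (hsub' a ha)
    rw [card_neighborFinset_eq_degree] at h1
    exact (hdeg a).trans h1
  · have key : ∀ x ∉ A, ∀ y ∈ A, G.Adj x y := by
      intro x hx y hy
      rw [← heq x hx] at hy
      simpa using hy
    intro x y
    refine ⟨h x y, fun hxy => ?_⟩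
    by_cases hx : x ∈ A
    · exact (key y (hxy.1 hx) x hx).symm
    · exact key x hx y (by tauto)

lemma aux_small {V : Type*} [Fintype V] [Nonempty V] {k : ℕ} (hk : 3 ≤ k)
    {G : SimpleGraph V} [DecidableRel G.Adj] (htf : G.CliqueFree 3)
    (hdeg : ∀ v : V, k ≤ G.degree v) (hV : Fintype.card V ≤ 2 * k + 1) :
    ∃ n, k ≤ n ∧ Nonempty (G ≃g completeBipartiteGraph (Fin k) (Fin n)) := by
  classical
  suffices ∃ A : Finset V, ∀ x y, G.Adj x y → (x ∈ A ↔ y ∉ A) by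
    obtain ⟨A, hA⟩ := this
    have hc := Finset.card_compl_add_card A
    by_cases h : A.card ≤ k
    · exact aux_bip (by omega) hdeg A h hA
    · refine aux_bip (by omega) hdeg Aᶜ (by omega) fun x y hxy => ?_
      have := hA x y hxy
      simp only [Finset.mem_compl]
      tauto
  obtain ⟨u⟩ := ‹Nonempty V›
  have : 0 < (G.neighborFinset u).card := by
    rw [card_neighborFinset_eq_degree]; have := hdeg u; omega
  obtain ⟨v, hv⟩ := Finset.card_pos.1 this
  have huv : G.Adj u v := by simpa using hv
  clear this hv
  have hdisj : ∀ x, G.Adj u x → ¬ G.Adj v x := fun x h1 h2 => aux_tri htf huv h1 h2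
  have hAi : ∀ x y, G.Adj u x → G.Adj u y → ¬ G.Adj x y := fun x y h1 h2 h3 => aux_tri htf h1 h2 h3
  have hBi : ∀ x y, G.Adj v x → G.Adj v y → ¬ G.Adj x y := fun x y h1 h2 h3 => aux_tri htf h1 h2 h3
  have hD : Disjoint (G.neighborFinset u) (G.neighborFinset v) := by
    rw [Finset.disjoint_left]
    intro a ha hb
    exact hdisj a (by simpa using ha) (by simpa using hb)
  have hcard := Finset.card_union_of_disjoint hD
  have hcompl := Finset.card_compl_add_card (G.neighborFinset u ∪ G.neighborFinset v)
  rw [card_neighborFinset_eq_degree, card_neighborFinset_eq_degree] at hcard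
  have hu := hdeg u
  have hv := hdeg v
  by_cases hw : ∃ w, ¬ G.Adj u w ∧ ¬ G.Adj v w
  swap
  · push Not at hw
    refine ⟨G.neighborFinset u, fun x y hxy => ?_⟩
    simp only [mem_neighborFinset]
    have := hAi x y
    have := hBi x y
    have := hw x
    have := hw y
    tauto
  obtain ⟨w, hwu, hwv⟩ := hw
  have hwm : w ∈ (G.neighborFinset u ∪ G.neighborFinset v)ᶜ := by simp [hwu, hwv]
  have hc1 : 1 ≤ ((G.neighborFinset u ∪ G.neighborFinset v)ᶜ).card := Finset.card_pos.2 ⟨w, hwm⟩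
  have hdu : G.degree u = k := by omega
  have hdv : G.degree v = k := by omega
  have hcov : ∀ x, G.Adj u x ∨ G.Adj v x ∨ x = w := by
    intro x
    by_contra! h
    have hx : x ∈ (G.neighborFinset u ∪ G.neighborFinset v)ᶜ := by simp [h]
    exact h.2.2 (Finset.card_le_one.1 (by omega) x hx w hwm)
  have hA2 : (∀ x, G.Adj v x → ¬ G.Adj w x) → ∃ A : Finset V, ∀ x y, G.Adj x y → (x ∈ A ↔ y ∉ A) := by
    intro hh
    refine ⟨G.neighborFinset u, fun x y hxy => ?_⟩
    simp only [mem_neighborFinset]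
    constructor
    · exact fun h h' => hAi x y h h' hxy
    · intro hy
      rcases hcov x with h | h | rfl
      · exact h
      · rcases hcov y with h' | h' | rfl
        · exact absurd h' hy
        · exact absurd hxy (hBi x y h h')
        · exact absurd hxy.symm (hh x h)
      · rcases hcov y with h' | h' | rfl
        · exact absurd h' hy
        · exact absurd hxy (hh y h')
        · exact absurd hxy (G.loopless.irrefl _)
  have hB2 : (∀ x, G.Adj u x → ¬ G.Adj w x) → ∃ A : Finset V, ∀ x y, G.Adj x y → (x ∈ A ↔ y ∉ A) := by
    intro hh
    refine ⟨G.neighborFinset v, fun x y hxy => ?_⟩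
    simp only [mem_neighborFinset]
    constructor
    · exact fun h h' => hBi x y h h' hxy
    · intro hy
      rcases hcov x with h | h | rfl
      · rcases hcov y with h' | h' | rfl
        · exact absurd hxy (hAi x y h h')
        · exact absurd h' hy
        · exact absurd hxy.symm (hh x h)
      · exact h
      · rcases hcov y with h' | h' | rfl
        · exact absurd hxy (hh y h')
        · exact absurd h' hy
        · exact absurd hxy (G.loopless.irrefl _)
  by_cases hb : ∀ x, G.Adj v x → ¬ G.Adj w x
  · exact hA2 hb
  by_cases ha : ∀ x, G.Adj u x → ¬ G.Adj w x
  · exact hB2 ha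
  exfalso
  push Not at ha hb
  obtain ⟨x, hux, hwx⟩ := ha
  obtain ⟨y, hvy, hwy⟩ := hb
  have h1 : G.neighborFinset x ⊆ insert w (G.neighborFinset v \ G.neighborFinset w) := by
    intro z hz
    have hz : G.Adj x z := by simpa using hz
    simp only [Finset.mem_insert, Finset.mem_sdiff, mem_neighborFinset]
    rcases hcov z with h | h | h
    · exact absurd hz (hAi x z hux h)
    · exact Or.inr ⟨h, fun h' => aux_tri htf hwx h' hz⟩
    · exact Or.inl h
  have h2 : G.neighborFinset y ⊆ insert w (G.neighborFinset u \ G.neighborFinset w) := by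
    intro z hz
    have hz : G.Adj y z := by simpa using hz
    simp only [Finset.mem_insert, Finset.mem_sdiff, mem_neighborFinset]
    rcases hcov z with h | h | h
    · exact Or.inr ⟨h, fun h' => aux_tri htf hwy h' hz⟩
    · exact absurd hz (hBi y z hvy h)
    · exact Or.inl h
  have h3 : G.neighborFinset w ⊆ (G.neighborFinset v ∩ G.neighborFinset w) ∪
      (G.neighborFinset u ∩ G.neighborFinset w) := by
    intro z hz
    have hz' : G.Adj w z := by simpa using hz
    simp only [Finset.mem_union, Finset.mem_inter, mem_neighborFinset]
    rcases hcov z with h | h | h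
    · tauto
    · tauto
    · exact absurd (h ▸ hz') (G.loopless.irrefl _)
  have c1 := (Finset.card_le_card h1).trans (Finset.card_insert_le _ _)
  have c2 := (Finset.card_le_card h2).trans (Finset.card_insert_le _ _)
  have c3 := (Finset.card_le_card h3).trans (Finset.card_union_le _ _)
  have c4 := Finset.card_sdiff_add_card_inter (G.neighborFinset v) (G.neighborFinset w)
  have c5 := Finset.card_sdiff_add_card_inter (G.neighborFinset u) (G.neighborFinset w)
  rw [card_neighborFinset_eq_degree] at c1 c2 c3 c4 c5
  have := hdeg x
  have := hdeg y
  have := hdeg w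
  omega

/-- Properties of longest paths: let `k ≥ 3` and let `G` be a 2-connected triangle-free graph
of minimum degree at least `k`, not isomorphic to `K_{k,n}` for any `n ≥ k`, with no cycle of
length at least `2k + 2`. Then for every longest path `P = v₀v₁…v_ℓ` in `G`: all neighbors of
`v₀` lie on `P`, the vertex `v₀` has exactly `k` neighbors, `v₀` and `v_ℓ` are non-adjacent,
`G` has no cycle of length `ℓ + 1`, and `ℓ ≥ 2k`. -/
theorem stmt_15 {V : Type*} [Fintype V] (k : ℕ) (hk : 3 ≤ k)
    (G : SimpleGraph V) [DecidableRel G.Adj]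
    (h2 : TwoConnected G) (htf : G.CliqueFree 3) (hdeg : ∀ v : V, k ≤ G.degree v)
    (hnotbip : ∀ n : ℕ, k ≤ n → IsEmpty (G ≃g completeBipartiteGraph (Fin k) (Fin n)))
    (hnocycle : ∀ ℓ : ℕ, 2 * k + 2 ≤ ℓ → ¬ HasCycleLength G ℓ) :
    ∀ (v₀ vℓ : V) (P : G.Walk v₀ vℓ), P.IsPath →
      (∀ (a b : V) (Q : G.Walk a b), Q.IsPath → Q.length ≤ P.length) →
      (∀ u : V, G.Adj v₀ u → u ∈ P.support) ∧
      G.degree v₀ = k ∧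
      ¬ G.Adj v₀ vℓ ∧
      ¬ HasCycleLength G (P.length + 1) ∧
      2 * k ≤ P.length := by
  classical
  intro v₀ vℓ P hP hmax
  have hnb : ∀ u : V, G.Adj v₀ u → u ∈ P.support := by
    intro u hu
    by_contra hc
    have := hmax _ _ (Walk.cons hu.symm P) ((Walk.cons_isPath_iff _ _).2 ⟨hP, hc⟩)
    simp at this
  let S : Finset ℕ := (Finset.range (P.length + 1)).filter fun i => G.Adj v₀ (P.getVert i)
  have hSm : ∀ i, i ∈ S ↔ i ≤ P.length ∧ G.Adj v₀ (P.getVert i) := by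
    intro i
    simp [S]
  have himg : S.image P.getVert = G.neighborFinset v₀ := by
    ext x
    simp only [Finset.mem_image, mem_neighborFinset, hSm]
    constructor
    · rintro ⟨i, hi, rfl⟩
      exact hi.2
    · intro hx
      obtain ⟨n, rfl, hn⟩ := Walk.mem_support_iff_exists_getVert.1 (hnb x hx)
      exact ⟨n, ⟨hn, hx⟩, rfl⟩
  have hScard : S.card = G.degree v₀ := by
    rw [← card_neighborFinset_eq_degree, ← himg, Finset.card_image_of_injOn]
    intro a ha b hb hab
    exact hP.getVert_injOn ((hSm a).1 ha).1 ((hSm b).1 hb).1 hab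
  have hd := hdeg v₀
  obtain ⟨i, hiS, hi⟩ := aux_idx S (Finset.card_pos.1 (by omega))
    (fun h => by simpa using ((hSm 0).1 h).2)
    (fun i h1 h2 => by
      have a1 := (hSm i).1 h1
      have a2 := (hSm (i + 1)).1 h2
      exact aux_tri htf a1.2 a2.2 (P.adj_getVert_succ (by omega)))
  obtain ⟨hil, hia⟩ := (hSm i).1 hiS
  have hcyc : HasCycleLength G (i + 1) := by
    have hl : (P.take i).length = i := by rw [Walk.take_length]; omega
    have := aux_cycle (P.take i) (hP.take i) (by omega) hia.symm
    rwa [hl] at this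
  have hi2 : i + 1 < 2 * k + 2 := by
    by_contra hc
    exact hnocycle _ (by omega) hcyc
  have hno : ¬ HasCycleLength G (P.length + 1) := by
    rintro ⟨u, c, hc, hcl⟩
    have hall : ∀ x, x ∈ c.support := by
      intro x
      by_contra hx
      obtain ⟨q⟩ := aux_conn h2 u x
      obtain ⟨d, -, hd1, hd2⟩ := q.exists_boundary_dart {y | y ∈ c.support} (by simp) hx
      simp only [Set.mem_setOf_eq] at hd1 hd2
      have hr : (c.rotate d.fst hd1).IsCycle := hc.rotate hd1
      have hnn : ¬ (c.rotate d.fst hd1).Nil := hr.not_nil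
      have hlen := Walk.length_tail_add_one hnn
      rw [Walk.length_rotate] at hlen
      have hp : ((c.rotate d.fst hd1).tail.concat d.adj).IsPath := by
        rw [Walk.concat_isPath_iff]
        refine ⟨hr.isPath_tail, fun hm => hd2 ?_⟩
        rw [Walk.support_tail_of_not_nil _ hnn] at hm
        exact (Walk.mem_support_rotate_iff c d.fst hd1).1 (List.mem_of_mem_tail hm)
      have := hmax _ _ _ hp
      rw [Walk.length_concat] at this
      omega
    have hlt : P.length + 1 < 2 * k + 2 := by
      by_contra hcon
      exact hnocycle _ (by omega) ⟨u, c, hc, hcl⟩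
    have hlen := Walk.length_tail_add_one hc.not_nil
    have hV : Fintype.card V ≤ 2 * k + 1 := by
      have hs : (Finset.univ : Finset V) ⊆ c.tail.support.toFinset := by
        intro x _
        rw [List.mem_toFinset, Walk.support_tail_of_not_nil _ hc.not_nil]
        rcases (Walk.mem_support_iff c).1 (hall x) with h | h
        · rw [h]; exact Walk.end_mem_tail_support hc.not_nil
        · exact h
      have h1 := (Finset.card_le_card hs).trans (List.toFinset_card_le _)
      rw [Walk.length_support, Finset.card_univ] at h1
      omega
    haveI : Nonempty V := ⟨v₀⟩
    obtain ⟨n, hn, hiso⟩ := aux_small hk htf hdeg hV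
    exact not_isEmpty_iff.2 hiso (hnotbip n hn)
  have hnadj : ¬ G.Adj v₀ vℓ := fun h => hno (aux_cycle P hP (by omega) h.symm)
  refine ⟨hnb, by omega, hnadj, hno, ?_⟩
  by_contra hcon
  have : i = P.length := by omega
  rw [this, Walk.getVert_length] at hia
  exact hnadj hia
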